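/- Let R be a commutative domain with ring automorphism σ, let H and J be ideals of R, and let G : ℤ →₀ ℤ be a pleasantly alternating cycle supported in [r, s] with G(r) = G(s) = 1; set N = s - r and I_n = H[(-G_n)^+] · J[(G_n)^+] for each n ∈ ℤ. Then I_m · σ^m(I_n) = I_{m+n} whenever m, n ≥ N, and also whenever m, n ≤ -N. -/

import Mathlib

/-- The shift of a cycle: `(shiftCyc j G) i = G (i + j)`, i.e. `σ^j(G)`. -/
def shiftCyc (j : ℤ) (G : ℤ →₀ ℤ) : ℤ →₀ ℤ :=
  Finsupp.equivMapDomain (Equiv.addRight (-j)) G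

/-- The cycles `G_n`: `G_0 = 0`; `G_n = Σ_{j=0}^{n-1} σ^{-j}(G)` for `n ≥ 1`; and
`G_{-n} = -Σ_{j=1}^{n} σ^{j}(G)` for `n ≥ 1`. -/
noncomputable def cyc (G : ℤ →₀ ℤ) (n : ℤ) : ℤ →₀ ℤ :=
  if 0 ≤ n then ∑ j ∈ Finset.range n.toNat, shiftCyc (-(j : ℤ)) G
  else -(∑ j ∈ Finset.Icc 1 (-n).toNat, shiftCyc (j : ℤ) G)

/-- `G` is pleasantly alternating with respect to the interval `[r, s]`. -/
def PleasantlyAlternatingOn (G : ℤ →₀ ℤ) (r s : ℤ) : Prop :=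
  r ≤ s ∧ G r = 1 ∧ G s = 1 ∧
  (∀ i, G i ≠ 0 → r ≤ i ∧ i ≤ s) ∧
  (∀ i, G i = -1 ∨ G i = 0 ∨ G i = 1) ∧
  (∀ i j, i < j → G i ≠ 0 → G j ≠ 0 → (∀ t, i < t → t < j → G t = 0) → G j = -G i)

/-- `G` is pleasantly alternating. -/
def PleasantlyAlternating (G : ℤ →₀ ℤ) : Prop :=
  ∃ r s : ℤ, PleasantlyAlternatingOn G r s

/-- The positive part `D^+ = max(D, 0)` of a cycle, taken pointwise. -/
noncomputable def cycPos (D : ℤ →₀ ℤ) : ℤ →₀ ℤ :=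
  Finsupp.mapRange (fun x => max x 0) (by simp) D

/-- For a cycle `D` with values in `{0, 1}`, `I[D] = ∏_{i : D(i) = 1} σ^i(I)`
(empty product is `R`). -/
noncomputable def idealOf {R : Type*} [CommRing R] (σ : R ≃+* R) (I : Ideal R)
    (D : ℤ →₀ ℤ) : Ideal R :=
  ∏ i ∈ D.support.filter (fun i => D i = 1), Ideal.map (σ ^ i) I

/-- The `n`-th component `I_n = H[(-G_n)^+] · J[(G_n)^+]` of the ring `B(G, H, J)`. -/
noncomputable def BIdeal {R : Type*} [CommRing R] (σ : R ≃+* R) (H J : Ideal R)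
    (G : ℤ →₀ ℤ) (n : ℤ) : Ideal R :=
  idealOf σ H (cycPos (-(cyc G n))) * idealOf σ J (cycPos (cyc G n))

theorem shiftCyc_apply (j : ℤ) (G : ℤ →₀ ℤ) (i : ℤ) : shiftCyc j G i = G (i + j) := by
  simp [shiftCyc, Finsupp.equivMapDomain_apply]

theorem cycPos_apply (D : ℤ →₀ ℤ) (i : ℤ) : cycPos D i = max (D i) 0 := rfl

theorem cycPos_apply_eq_one_iff (D : ℤ →₀ ℤ) (i : ℤ) : cycPos D i = 1 ↔ D i = 1 := by
  rw [cycPos_apply]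
  omega

/-- If `S` is a primitive of `G`, then `G_n` is a difference of two values of `S`. -/
theorem cyc_apply_eq_sub {G : ℤ →₀ ℤ} {S : ℤ → ℤ} (hS : ∀ i, S i - S (i - 1) = G i)
    (n i : ℤ) : cyc G n i = S i - S (i - n) := by
  rw [cyc]
  split_ifs with h
  · obtain ⟨k, rfl⟩ := Int.eq_ofNat_of_zero_le h
    simp only [Int.toNat_natCast, Finsupp.coe_finsetSum, Finset.sum_apply, shiftCyc_apply]
    clear h
    induction k with
    | zero => simp
    | succ k ih =>
      rw [Finset.sum_range_succ, ih, ← hS]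
      push_cast
      rw [← sub_eq_add_neg, sub_sub i k 1]
      ring
  · obtain ⟨k, hk⟩ := Int.eq_ofNat_of_zero_le (show 0 ≤ -n by omega)
    obtain rfl : n = -(k : ℤ) := by omega
    simp only [neg_neg, Int.toNat_natCast, Finsupp.coe_neg, Pi.neg_apply,
      Finsupp.coe_finsetSum, Finset.sum_apply, shiftCyc_apply]
    clear h hk
    induction k with
    | zero => simp
    | succ k ih =>
      rw [Finset.sum_Icc_succ_top (by omega), neg_add, ih, ← hS]
      push_cast
      rw [show i + ((k : ℤ) + 1) - 1 = i - -(k : ℤ) by ring,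
        show i - -((k : ℤ) + 1) = i + ((k : ℤ) + 1) by ring]
      ring

/-- A pleasantly alternating cycle has a primitive with values in `{0, 1}` which vanishes before
`r` and equals `1` from `s` on. -/
theorem PleasantlyAlternatingOn.exists_primitive {G : ℤ →₀ ℤ} {r s : ℤ}
    (hG : PleasantlyAlternatingOn G r s) :
    ∃ S : ℤ → ℤ, (∀ i, S i - S (i - 1) = G i) ∧ (∀ i, S i = 0 ∨ S i = 1) ∧
      (∀ i, i < r → S i = 0) ∧ ∀ i, s ≤ i → S i = 1 := by
  obtain ⟨hrs, hr, hs, hsupp, hval, halt⟩ := hG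
  set S : ℤ → ℤ := fun i => ∑ t ∈ Finset.Icc r i, G t with hSdef
  have hlt : ∀ i, i < r → S i = 0 := fun i hi => by simp [hSdef, Finset.Icc_eq_empty_of_lt hi]
  have hstep : ∀ i, S i - S (i - 1) = G i := by
    intro i
    by_cases hi : r ≤ i
    · have hins : Finset.Icc r i = insert i (Finset.Icc r (i - 1)) := by
        ext t
        simp only [Finset.mem_Icc, Finset.mem_insert]
        omega
      simp only [hSdef]
      rw [hins, Finset.sum_insert (by simp)]
      ring
    · have h0 : G i = 0 := by
        by_contra h
        exact hi (hsupp i h).1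
      rw [hlt i (by omega), hlt (i - 1) (by omega), h0, sub_zero]
  have hlast : ∀ i, r ≤ i → (S i = 0 ∨ S i = 1) ∧
      ∃ l ≤ i, G l = 2 * S i - 1 ∧ ∀ t, l < t → t ≤ i → G t = 0 := by
    intro i hi
    induction i, hi using Int.leInduction with
    | base =>
      have h1 := hstep r
      rw [hlt (r - 1) (by omega)] at h1
      exact ⟨by omega, r, le_rfl, by omega, fun t h h' => by omega⟩
    | succ i hi ih =>
      obtain ⟨h01, l, hl, hGl, hz⟩ := ih
      have h1 := hstep (i + 1)
      rw [add_sub_cancel_right] at h1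
      by_cases h0 : G (i + 1) = 0
      · refine ⟨by omega, l, by omega, by omega, fun t ht ht' => ?_⟩
        rcases eq_or_lt_of_le ht' with rfl | h
        · exact h0
        · exact hz t ht (by omega)
      · have h2 := halt l (i + 1) (by omega) (by omega) h0 fun t ht ht' => hz t ht (by omega)
        exact ⟨by omega, i + 1, le_rfl, by omega, fun t h h' => by omega⟩
  refine ⟨S, hstep, fun i => ?_, hlt, fun i hi => ?_⟩
  · rcases lt_or_ge i r with h | h
    · exact Or.inl (hlt i h)
    · exact (hlast i h).1
  · obtain ⟨h01, l, -, hGl, hz⟩ := hlast i (by omega)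
    have hls : l ≤ s := (hsupp l (by omega)).2
    rcases eq_or_lt_of_le hls with rfl | h
    · omega
    · have := hz s h hi
      omega

theorem map_zpow_map_zpow {R : Type*} [CommRing R] (σ : R ≃+* R) (I : Ideal R) (m i : ℤ) :
    Ideal.map (σ ^ m) (Ideal.map (σ ^ i) I) = Ideal.map (σ ^ (m + i)) I := by
  rw [zpow_add]
  exact Ideal.map_map (σ ^ i : R ≃+* R).toRingHom (σ ^ m : R ≃+* R).toRingHom

/-- If the set where `F = 1` is the disjoint union of the set where `D = 1` and the translate by
`m` of the set where `E = 1`, then `I[D] · σ^m(I[E]) = I[F]`. -/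
theorem idealOf_mul_map_idealOf {R : Type*} [CommRing R] (σ : R ≃+* R) (I : Ideal R)
    {D E F : ℤ →₀ ℤ} {m : ℤ} (hdisj : ∀ i, D i = 1 → E (i - m) ≠ 1)
    (hF : ∀ i, F i = 1 ↔ D i = 1 ∨ E (i - m) = 1) :
    idealOf σ I D * Ideal.map (σ ^ m) (idealOf σ I E) = idealOf σ I F := by
  have hmem : ∀ (A : ℤ →₀ ℤ) (i : ℤ), i ∈ A.support.filter (fun i => A i = 1) ↔ A i = 1 := by
    intro A i
    simp only [Finset.mem_filter, Finsupp.mem_support_iff]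
    omega
  have hunion : F.support.filter (fun i => F i = 1) = D.support.filter (fun i => D i = 1) ∪
      (E.support.filter (fun i => E i = 1)).map (Equiv.addLeft m).toEmbedding := by
    ext i
    rw [Finset.mem_union, Finset.mem_map_equiv, hmem, hmem, hmem, hF]
    simp [sub_eq_neg_add]
  unfold idealOf
  rw [hunion, Finset.prod_union, Finset.prod_map]
  · congr 1
    refine (map_prod (Ideal.mapHom (σ ^ m : R ≃+* R)) _ _).trans (Finset.prod_congr rfl ?_)
    intro i _
    exact map_zpow_map_zpow σ I m i
  · rw [Finset.disjoint_left]
    intro i hi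
    rw [Finset.mem_map_equiv, hmem]
    rw [hmem] at hi
    simpa [sub_eq_neg_add] using hdisj i hi

/-- `I_m · σ^m(I_n) = I_{m+n}` whenever `m, n ≥ N` and whenever `m, n ≤ -N`,
where `N = s - r`. -/
theorem BIdeal_mul_eq (R : Type*) [CommRing R] [IsDomain R] (σ : R ≃+* R)
    (H J : Ideal R) (G : ℤ →₀ ℤ) (r s : ℤ) (hG : PleasantlyAlternatingOn G r s)
    (N : ℤ) (hN : N = s - r) :
    (∀ m n : ℤ, N ≤ m → N ≤ n →
      BIdeal σ H J G m * Ideal.map (σ ^ m) (BIdeal σ H J G n) = BIdeal σ H J G (m + n)) ∧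
    (∀ m n : ℤ, m ≤ -N → n ≤ -N →
      BIdeal σ H J G m * Ideal.map (σ ^ m) (BIdeal σ H J G n) = BIdeal σ H J G (m + n)) := by
  subst hN
  obtain ⟨S, hstep, h01, hlt, hge⟩ := hG.exists_primitive
  have hcyc := cyc_apply_eq_sub hstep
  have key : ∀ m n : ℤ,
      ((∀ i, S i = 0 → S (i - m) = 0) ∧ (∀ i, S i = 0 → S (i - n) = 0) ∨
        (∀ i, S i = 1 → S (i - m) = 1) ∧ ∀ i, S i = 1 → S (i - n) = 1) →
      BIdeal σ H J G m * Ideal.map (σ ^ m) (BIdeal σ H J G n) = BIdeal σ H J G (m + n) := by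
    intro m n h
    unfold BIdeal
    rw [Ideal.map_mul, mul_mul_mul_comm]
    have hcases : ∀ i, (S i = 0 → S (i - m) = 0) ∧ (S (i - m) = 0 → S (i - (m + n)) = 0) ∨
        (S i = 1 → S (i - m) = 1) ∧ (S (i - m) = 1 → S (i - (m + n)) = 1) := by
      intro i
      rw [← sub_sub]
      exact h.imp (fun h => ⟨h.1 i, h.2 _⟩) fun h => ⟨h.1 i, h.2 _⟩
    congr 1 <;> refine idealOf_mul_map_idealOf σ _ (fun i => ?_) (fun i => ?_) <;>
    · have h1 := hcases i
      have ha := h01 i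
      have hb := h01 (i - m)
      have hc := h01 (i - (m + n))
      simp only [ne_eq, cycPos_apply_eq_one_iff, Finsupp.neg_apply, hcyc, sub_sub]
      omega
  constructor
  · have hmono : ∀ m, s - r ≤ m → ∀ i, S i = 0 → S (i - m) = 0 := by
      intro m hm i hi
      refine hlt _ ?_
      by_contra h
      have := hge i (by omega)
      omega
    exact fun m n hm hn => key m n (Or.inl ⟨hmono m hm, hmono n hn⟩)
  · have hmono : ∀ m, m ≤ -(s - r) → ∀ i, S i = 1 → S (i - m) = 1 := by
      intro m hm i hi
      refine hge _ ?_
      by_contra h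
      have := hlt i (by omega)
      omega
    exact fun m n hm hn => key m n (Or.inr ⟨hmono m hm, hmono n hn⟩)
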